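/- Let d ∈ {1,2} and let μ, {μ_k} be probability measures on ℤ^d all supported in a common finite set F ⊆ ℤ^d, with μ_k(g) → μ(g) for all g. Then the escape probabilities converge: p_esc(μ_k) → p_esc(μ). -/

import Mathlib

open Real Filter
open scoped ENNReal Classical

noncomputable section

/-- A probability mass function on a countable set, as a real-valued function. -/
def IsPMF {G : Type*} (μ : G → ℝ) : Prop := (∀ g, 0 ≤ μ g) ∧ ∑' g, μ g = 1

/-- Convolution of two measures on a group. -/
def conv {G : Type*} [Group G] (μ ν : G → ℝ) : G → ℝ := fun g => ∑' h : G, μ h * ν (h⁻¹ * g)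

/-- `n`-fold convolution power, with `μ^{*0} = δ_e`. -/
def convPow {G : Type*} [Group G] (μ : G → ℝ) : ℕ → G → ℝ
  | 0 => fun g => if g = 1 then 1 else 0
  | n + 1 => conv (convPow μ n) μ

/-- Shannon entropy of a measure on a countable set. -/
def Hent {G : Type*} (μ : G → ℝ) : ℝ := ∑' g : G, Real.negMulLog (μ g)

/-- Position of the random walk after `m` steps, given the first `n` increments. -/
def walkProd {G : Type*} [Monoid G] {n : ℕ} (g : Fin n → G) (m : ℕ) : G :=
  ((List.ofFn g).take m).prod

/-- The escape probability of the `μ`-random walk: the probability of never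
returning to the identity at any positive time, expressed as the infimum of the
finite-time non-return probabilities. -/
def pesc {G : Type*} [Group G] (μ : G → ℝ) : ℝ :=
  ⨅ n : ℕ, ∑' g : Fin n → G,
    if ∀ m, 1 ≤ m → m ≤ n → walkProd g m ≠ 1 then ∏ i, μ (g i) else 0

lemma IsPMF.sum_eq_one {G : Type*} {F : Finset G} {μ : G → ℝ} (h : IsPMF μ)
    (hF : ∀ g, μ g ≠ 0 → g ∈ F) : ∑ y ∈ F, μ y = 1 := by
  rw [← h.2, tsum_eq_sum fun g hg => by_contra fun h' => hg (hF g h')]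

section Walk

variable {G : Type*} [Group G]

lemma walkProd_zero {n : ℕ} (g : Fin n → G) : walkProd g 0 = 1 := by
  simp [walkProd]

lemma walkProd_cons_succ {n : ℕ} (y : G) (g : Fin n → G) (m : ℕ) :
    walkProd (Fin.cons y g : Fin (n + 1) → G) (m + 1) = y * walkProd g m := by
  simp [walkProd, List.ofFn_succ]

/-- The probability that the walk started at `x` with steps in `F` avoids `1` at times `1, …, n`. -/
def avoidProb (F : Finset G) (μ : G → ℝ) : ℕ → G → ℝ
  | 0 => fun _ => 1
  | n + 1 => fun x => ∑ y ∈ F, μ y * if x * y = 1 then 0 else avoidProb F μ n (x * y)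

/-- The probability that the walk started at `x` with steps in `F` is at `1` at time `n`. -/
def hitProb (F : Finset G) (μ : G → ℝ) : ℕ → G → ℝ
  | 0 => fun x => if x = 1 then 1 else 0
  | n + 1 => fun x => ∑ y ∈ F, μ y * hitProb F μ n (x * y)

lemma avoidProb_succ (F : Finset G) (μ : G → ℝ) (n : ℕ) (x : G) : avoidProb F μ (n + 1) x =
    ∑ y ∈ F, μ y * if x * y = 1 then 0 else avoidProb F μ n (x * y) := rfl

lemma hitProb_succ (F : Finset G) (μ : G → ℝ) (n : ℕ) (x : G) :
    hitProb F μ (n + 1) x = ∑ y ∈ F, μ y * hitProb F μ n (x * y) := rfl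

lemma avoids_cons_iff {n : ℕ} (x y : G) (g : Fin n → G) :
    (∀ m, 1 ≤ m → m ≤ n + 1 → x * walkProd (Fin.cons y g : Fin (n + 1) → G) m ≠ 1) ↔
      x * y ≠ 1 ∧ ∀ m, 1 ≤ m → m ≤ n → x * y * walkProd g m ≠ 1 := by
  constructor
  · intro h
    refine ⟨?_, fun m _ hm => ?_⟩
    · simpa [walkProd_cons_succ, walkProd_zero] using h 1 le_rfl (by omega)
    · simpa [walkProd_cons_succ, mul_assoc] using h (m + 1) (by omega) (by omega)
  · rintro ⟨h1, h2⟩ m hm1 hm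
    obtain ⟨m, rfl⟩ : ∃ j, m = j + 1 := ⟨m - 1, by omega⟩
    rw [walkProd_cons_succ, ← mul_assoc]
    rcases Nat.eq_zero_or_pos m with rfl | h0
    · simpa [walkProd_zero] using h1
    · exact h2 m h0 (by omega)

lemma sum_piFinset_eq_avoidProb (F : Finset G) (μ : G → ℝ) (n : ℕ) (x : G) :
    (∑ g ∈ Fintype.piFinset (fun _ : Fin n => F),
      if ∀ m, 1 ≤ m → m ≤ n → x * walkProd g m ≠ 1 then ∏ i, μ (g i) else 0) =
      avoidProb F μ n x := by
  induction n generalizing x with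
  | zero =>
    have h : ∀ m : ℕ, 1 ≤ m → ¬ m ≤ 0 := by omega
    simp +contextual [avoidProb, h]
  | succ n ih =>
    have key : (∑ g ∈ Fintype.piFinset (fun _ : Fin (n + 1) => F),
        if ∀ m, 1 ≤ m → m ≤ n + 1 → x * walkProd g m ≠ 1 then ∏ i, μ (g i) else 0) =
        ∑ p ∈ F ×ˢ Fintype.piFinset (fun _ : Fin n => F), μ p.1 *
          if x * p.1 = 1 then 0 else
          if ∀ m, 1 ≤ m → m ≤ n → x * p.1 * walkProd p.2 m ≠ 1 then ∏ i, μ (p.2 i) else 0 := by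
      symm
      refine Finset.sum_nbij' (fun p => (Fin.cons p.1 p.2 : Fin (n + 1) → G))
        (fun g => (g 0, Fin.tail g)) ?_ ?_ ?_ ?_ ?_
      · rintro ⟨y, g⟩ h
        simp only [Finset.mem_product, Fintype.mem_piFinset] at h ⊢
        exact Fin.cases h.1 h.2
      · intro g h
        simp only [Finset.mem_product, Fintype.mem_piFinset] at h ⊢
        exact ⟨h 0, fun i => h i.succ⟩
      · rintro ⟨y, g⟩ _
        simp
      · intro g _
        simp
      · rintro ⟨y, g⟩ _
        simp only [avoids_cons_iff, Fin.prod_univ_succ, Fin.cons_zero, Fin.cons_succ]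
        by_cases h : x * y = 1 <;> simp [h]
    rw [key, Finset.sum_product, avoidProb_succ]
    refine Finset.sum_congr rfl fun y _ => ?_
    dsimp only
    rw [← ih, ← Finset.mul_sum]
    by_cases h : x * y = 1
    · simp [h]
    · simp only [h, if_false]

lemma pesc_eq_iInf_avoidProb {F : Finset G} {μ : G → ℝ} (hF : ∀ g, μ g ≠ 0 → g ∈ F) :
    pesc μ = ⨅ n, avoidProb F μ n 1 := by
  refine iInf_congr fun n => ?_
  rw [← sum_piFinset_eq_avoidProb]
  refine (tsum_eq_sum (s := Fintype.piFinset fun _ => F) fun g hg => ?_).trans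
    (Finset.sum_congr rfl fun g _ => by simp only [one_mul]; congr)
  simp only [Fintype.mem_piFinset, not_forall] at hg
  obtain ⟨i, hi⟩ := hg
  rw [Finset.prod_eq_zero (Finset.mem_univ i) (by_contra fun h => hi (hF _ h)), ite_self]

variable {F : Finset G} {μ : G → ℝ}

lemma avoidProb_nonneg (h0 : ∀ g, 0 ≤ μ g) (n : ℕ) (x : G) : 0 ≤ avoidProb F μ n x := by
  induction n generalizing x with
  | zero => simp [avoidProb]
  | succ n ih =>
    refine Finset.sum_nonneg fun y _ => mul_nonneg (h0 y) ?_
    split_ifs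
    exacts [le_rfl, ih _]

lemma hitProb_nonneg (h0 : ∀ g, 0 ≤ μ g) (n : ℕ) (x : G) : 0 ≤ hitProb F μ n x := by
  induction n generalizing x with
  | zero => simp only [hitProb]; positivity
  | succ n ih => exact Finset.sum_nonneg fun y _ => mul_nonneg (h0 y) (ih _)

lemma avoidProb_succ_le (h0 : ∀ g, 0 ≤ μ g) (h1 : ∑ y ∈ F, μ y = 1) (n : ℕ) (x : G) :
    avoidProb F μ (n + 1) x ≤ avoidProb F μ n x := by
  induction n generalizing x with
  | zero =>
    rw [avoidProb_succ, show avoidProb F μ 0 x = ∑ y ∈ F, μ y from h1.symm]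
    refine Finset.sum_le_sum fun y _ => mul_le_of_le_one_right (h0 y) ?_
    simp only [avoidProb]
    split_ifs <;> norm_num
  | succ n ih =>
    rw [avoidProb_succ, avoidProb_succ]
    refine Finset.sum_le_sum fun y _ => mul_le_mul_of_nonneg_left ?_ (h0 y)
    split_ifs
    exacts [le_rfl, ih _]

lemma avoidProb_sub_succ_le (h0 : ∀ g, 0 ≤ μ g) (h1 : ∑ y ∈ F, μ y = 1) (n : ℕ) (x : G) :
    avoidProb F μ n x - avoidProb F μ (n + 1) x ≤ hitProb F μ (n + 1) x := by
  induction n generalizing x with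
  | zero =>
    rw [avoidProb_succ, hitProb_succ, show avoidProb F μ 0 x = ∑ y ∈ F, μ y from h1.symm,
      ← Finset.sum_sub_distrib]
    refine Finset.sum_le_sum fun y _ => le_of_eq ?_
    simp only [avoidProb, hitProb]
    split_ifs <;> ring
  | succ n ih =>
    rw [avoidProb_succ, avoidProb_succ, hitProb_succ, ← Finset.sum_sub_distrib]
    refine Finset.sum_le_sum fun y _ => ?_
    rw [← mul_sub]
    refine mul_le_mul_of_nonneg_left ?_ (h0 y)
    split_ifs
    · simpa using hitProb_nonneg h0 _ _
    · exact ih _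

/-- Decomposition of the walk started at `x` according to its last visit to `1` up to time `n`. -/
lemma last_visit_decomposition (h1 : ∑ y ∈ F, μ y = 1) (n : ℕ) (x : G) :
    (∑ m ∈ Finset.range (n + 1), hitProb F μ m x * avoidProb F μ (n - m) 1) +
      (if x = 1 then 0 else avoidProb F μ n x) = 1 := by
  induction n generalizing x with
  | zero => simp [hitProb, avoidProb]; split_ifs <;> simp
  | succ n ih =>
    rw [Finset.sum_range_succ']
    have key : ∑ m ∈ Finset.range (n + 1),
        hitProb F μ (m + 1) x * avoidProb F μ (n + 1 - (m + 1)) 1 =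
        1 - avoidProb F μ (n + 1) x := by
      simp only [hitProb_succ, Finset.sum_mul, Nat.add_sub_add_right]
      rw [Finset.sum_comm, avoidProb_succ, ← h1, ← Finset.sum_sub_distrib]
      refine Finset.sum_congr rfl fun y _ => ?_
      simp only [mul_assoc]
      rw [← Finset.mul_sum, ← mul_one_sub, ← ih (x * y)]
      ring
    rw [key]
    simp only [hitProb, Nat.sub_zero]
    split_ifs with hx
    · subst hx; ring
    · ring

lemma bddBelow_avoidProb (h0 : ∀ g, 0 ≤ μ g) (x : G) :
    BddBelow (Set.range fun n => avoidProb F μ n x) :=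
  ⟨0, by rintro _ ⟨n, rfl⟩; exact avoidProb_nonneg h0 n x⟩

lemma sum_hitProb_mul_pesc_le_one (h0 : ∀ g, 0 ≤ μ g) (h1 : ∑ y ∈ F, μ y = 1)
    (hF : ∀ g, μ g ≠ 0 → g ∈ F) (n : ℕ) :
    (∑ m ∈ Finset.range (n + 1), hitProb F μ m 1) * pesc μ ≤ 1 := by
  have h := last_visit_decomposition h1 n 1
  rw [if_pos rfl, add_zero] at h
  rw [← h, Finset.sum_mul]
  refine Finset.sum_le_sum fun m _ => mul_le_mul_of_nonneg_left ?_ (hitProb_nonneg h0 _ _)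
  rw [pesc_eq_iInf_avoidProb hF]
  exact ciInf_le (bddBelow_avoidProb h0 1) _

lemma pesc_nonneg (h0 : ∀ g, 0 ≤ μ g) (hF : ∀ g, μ g ≠ 0 → g ∈ F) : 0 ≤ pesc μ := by
  rw [pesc_eq_iInf_avoidProb hF]
  exact le_ciInf fun n => avoidProb_nonneg h0 n 1

lemma hitProb_le_mul_pow (h0 : ∀ g, 0 ≤ μ g) (χ : G →* ℝ) (hχ : ∀ g, 0 ≤ χ g)
    (n : ℕ) (x : G) : hitProb F μ n x ≤ χ x * (∑ y ∈ F, μ y * χ y) ^ n := by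
  induction n generalizing x with
  | zero =>
    simp only [hitProb, pow_zero, mul_one]
    split_ifs with h
    · simp [h]
    · exact hχ x
  | succ n ih =>
    rw [hitProb_succ, pow_succ', Finset.sum_mul, Finset.mul_sum]
    refine Finset.sum_le_sum fun y _ => ?_
    calc μ y * hitProb F μ n (x * y) ≤ μ y * (χ (x * y) * (∑ y ∈ F, μ y * χ y) ^ n) :=
          mul_le_mul_of_nonneg_left (ih _) (h0 y)
      _ = _ := by rw [map_mul]; ring

lemma avoidProb_sub_pesc_le (h0 : ∀ g, 0 ≤ μ g) (h1 : ∑ y ∈ F, μ y = 1)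
    (hF : ∀ g, μ g ≠ 0 → g ∈ F) {ρ : ℝ} (hρ0 : 0 ≤ ρ) (hρ1 : ρ < 1)
    (hp : ∀ n, hitProb F μ n 1 ≤ ρ ^ n) (n : ℕ) :
    avoidProb F μ n 1 - pesc μ ≤ ρ ^ n / (1 - ρ) := by
  have h1ρ : 0 < 1 - ρ := sub_pos.2 hρ1
  have hk : ∀ k, avoidProb F μ n 1 - avoidProb F μ (n + k) 1 ≤
      (ρ ^ n - ρ ^ (n + k)) / (1 - ρ) := by
    intro k
    induction k with
    | zero => simp
    | succ k ih =>
      have h2 := (avoidProb_sub_succ_le h0 h1 (n + k) 1).trans (hp _)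
      have h3 : ρ ^ (n + k + 1) ≤ ρ ^ (n + k) := pow_le_pow_of_le_one hρ0 hρ1.le (by omega)
      have h4 : (ρ ^ n - ρ ^ (n + (k + 1))) / (1 - ρ) =
          (ρ ^ n - ρ ^ (n + k)) / (1 - ρ) + ρ ^ (n + k) := by
        field_simp
        ring
      rw [h4, ← add_assoc]
      linarith
  rw [pesc_eq_iInf_avoidProb hF, sub_le_comm]
  refine le_ciInf fun m => ?_
  have hanti : Antitone fun n => avoidProb F μ n 1 :=
    antitone_nat_of_succ_le fun n => avoidProb_succ_le h0 h1 n 1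
  refine le_trans ?_ (hanti (Nat.le_add_left m n))
  rw [sub_le_comm]
  refine (hk m).trans ?_
  gcongr
  have : 0 ≤ ρ ^ (n + m) := by positivity
  linarith

lemma tendsto_avoidProb {ι : Type*} {l : Filter ι} {μk : ι → G → ℝ}
    (h : ∀ g, Tendsto (fun k => μk k g) l (nhds (μ g))) (n : ℕ) (x : G) :
    Tendsto (fun k => avoidProb F (μk k) n x) l (nhds (avoidProb F μ n x)) := by
  induction n generalizing x with
  | zero => exact tendsto_const_nhds
  | succ n ih =>
    simp only [avoidProb_succ]
    refine tendsto_finsetSum _ fun y _ => (h y).mul ?_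
    split_ifs
    exacts [tendsto_const_nhds, ih _]

/-- Upper semicontinuity of the escape probability at a recurrent measure. -/
lemma tendsto_pesc_of_pesc_eq_zero {ι : Type*} {l : Filter ι} {μk : ι → G → ℝ}
    (hk0 : ∀ k g, 0 ≤ μk k g) (hF : ∀ g, μ g ≠ 0 → g ∈ F) (hFk : ∀ k g, μk k g ≠ 0 → g ∈ F)
    (h : ∀ g, Tendsto (fun k => μk k g) l (nhds (μ g))) (hμ : pesc μ = 0) :
    Tendsto (fun k => pesc (μk k)) l (nhds (pesc μ)) := by
  rw [hμ]
  refine tendsto_order.2 ⟨fun a ha => Eventually.of_forall fun k =>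
    ha.trans_le (pesc_nonneg (hk0 k) (hFk k)), fun a ha => ?_⟩
  obtain ⟨n, hn⟩ : ∃ n, avoidProb F μ n 1 < a := by
    rw [pesc_eq_iInf_avoidProb hF] at hμ
    exact exists_lt_of_ciInf_lt (hμ ▸ ha)
  filter_upwards [(tendsto_avoidProb h n 1).eventually_lt_const hn] with k hk
  rw [pesc_eq_iInf_avoidProb (hFk k)]
  exact (ciInf_le (bddBelow_avoidProb (hk0 k) 1) n).trans_lt hk

/-- Continuity of the escape probability at a measure with a contracting character. -/
lemma tendsto_pesc_of_sum_mul_lt_one {ι : Type*} {l : Filter ι} {μk : ι → G → ℝ}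
    (hμ : IsPMF μ) (hμk : ∀ k, IsPMF (μk k))
    (hF : ∀ g, μ g ≠ 0 → g ∈ F) (hFk : ∀ k g, μk k g ≠ 0 → g ∈ F)
    (h : ∀ g, Tendsto (fun k => μk k g) l (nhds (μ g)))
    (χ : G →* ℝ) (hχ : ∀ g, 0 ≤ χ g) (hlt : ∑ y ∈ F, μ y * χ y < 1) :
    Tendsto (fun k => pesc (μk k)) l (nhds (pesc μ)) := by
  obtain ⟨ρ, hρ, hρ1⟩ := exists_between hlt
  have hnn : ∀ {ν : G → ℝ}, IsPMF ν → 0 ≤ ∑ y ∈ F, ν y * χ y := fun hν =>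
    Finset.sum_nonneg fun y _ => mul_nonneg (hν.1 y) (hχ y)
  have hρ0 : 0 ≤ ρ := (hnn hμ).trans hρ.le
  have hbd : ∀ {ν : G → ℝ}, IsPMF ν → (∀ g, ν g ≠ 0 → g ∈ F) → ∑ y ∈ F, ν y * χ y < ρ →
      ∀ n, dist (pesc ν) (avoidProb F ν n 1) ≤ ρ ^ n / (1 - ρ) := by
    intro ν hν hFν hlt n
    rw [Real.dist_eq, abs_sub_comm, abs_of_nonneg]
    · refine avoidProb_sub_pesc_le hν.1 (hν.sum_eq_one hFν) hFν hρ0 hρ1 (fun n => ?_) n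
      refine (hitProb_le_mul_pow hν.1 χ hχ n 1).trans ?_
      rw [map_one, one_mul]
      exact pow_le_pow_left₀ (hnn hν) hlt.le n
    · rw [sub_nonneg, pesc_eq_iInf_avoidProb hFν]
      exact ciInf_le (bddBelow_avoidProb hν.1 1) n
  have hev : ∀ᶠ k in l, ∑ y ∈ F, μk k y * χ y < ρ :=
    (tendsto_finsetSum F fun y _ => (h y).mul_const (χ y)).eventually_lt_const hρ
  have hlim : Tendsto (fun n : ℕ => ρ ^ n / (1 - ρ)) atTop (nhds 0) := by
    simpa using (tendsto_pow_atTop_nhds_zero_of_lt_one hρ0 hρ1).div_const (1 - ρ)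
  rw [Metric.tendsto_nhds]
  intro ε hε
  obtain ⟨n, hn⟩ := (hlim.eventually_lt_const (by positivity : (0 : ℝ) < ε / 3)).exists
  filter_upwards [hev, Metric.tendsto_nhds.1 (tendsto_avoidProb (F := F) h n 1) (ε / 3)
    (by positivity)] with k hk1 hk2
  have ha := hbd (hμk k) (hFk k) hk1 n
  have hb := hbd hμ hF hρ n
  rw [dist_comm] at hb
  have := dist_triangle4 (pesc (μk k)) (avoidProb F (μk k) n 1) (avoidProb F μ n 1) (pesc μ)
  linarith

end Walk

section Fourier

open MeasureTheory

variable {d : ℕ}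

/-- The pairing of a frequency in `ℝ^d` with a point of `ℤ^d`. -/
def phase (θ : Fin d → ℝ) (x : Multiplicative (Fin d → ℤ)) : ℝ := ∑ j, θ j * (x.toAdd j : ℝ)

/-- The characteristic function of a measure supported in `F`. -/
def charSum (F : Finset (Multiplicative (Fin d → ℤ))) (μ : Multiplicative (Fin d → ℤ) → ℝ)
    (θ : Fin d → ℝ) : ℂ := ∑ y ∈ F, (μ y : ℂ) * Complex.exp (phase θ y * Complex.I)

/-- The fundamental domain `(-π, π]^d` of the dual torus. -/
def freqBox (d : ℕ) : Set (Fin d → ℝ) := Set.univ.pi fun _ => Set.Ioc (-π) π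

lemma phase_mul (θ : Fin d → ℝ) (x y : Multiplicative (Fin d → ℤ)) :
    phase θ (x * y) = phase θ x + phase θ y := by
  simp [phase, mul_add, Finset.sum_add_distrib]

lemma continuous_phase (x : Multiplicative (Fin d → ℤ)) : Continuous fun θ => phase θ x := by
  unfold phase
  fun_prop

instance : IsFiniteMeasure (volume.restrict (freqBox d)) := by
  refine ⟨?_⟩
  rw [Measure.restrict_apply_univ, freqBox, Real.volume_pi_Ioc]
  exact ENNReal.prod_lt_top fun i _ => ENNReal.ofReal_lt_top

lemma measurableSet_freqBox : MeasurableSet (freqBox d) :=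
  MeasurableSet.univ_pi fun _ => measurableSet_Ioc

lemma integral_exp_int (n : ℤ) : ∫ t in Set.Ioc (-π) π, Complex.exp ((t * n : ℝ) * Complex.I) =
    if n = 0 then 2 * (π : ℂ) else 0 := by
  rw [← intervalIntegral.integral_of_le (by linarith [pi_pos])]
  split_ifs with h
  · simp [h]
    ring
  · have hc : (n : ℂ) * Complex.I ≠ 0 := by simp [h]
    have := integral_exp_mul_complex (a := -π) (b := π) hc
    calc _ = ∫ t in (-π)..π, Complex.exp ((n : ℂ) * Complex.I * t) := by
          congr 1; ext t; congr 1; push_cast; ring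
      _ = 0 := by
          rw [this, div_eq_zero_iff, sub_eq_zero]
          left
          rw [Complex.exp_eq_exp_iff_exists_int]
          exact ⟨n, by push_cast; ring⟩

lemma integral_exp_phase (x : Multiplicative (Fin d → ℤ)) :
    ∫ θ in freqBox d, Complex.exp (phase θ x * Complex.I) =
      (2 * π : ℂ) ^ d * if x = 1 then 1 else 0 := by
  have h : ∀ θ : Fin d → ℝ, Complex.exp (phase θ x * Complex.I) =
      ∏ j, Complex.exp ((θ j * (x.toAdd j : ℝ) : ℝ) * Complex.I) := by
    intro θ
    rw [← Complex.exp_sum, phase, ← Finset.sum_mul]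
    push_cast
    rfl
  simp only [h]
  rw [freqBox, volume_pi, Measure.restrict_pi_pi, integral_fintype_prod_eq_prod
    (f := fun j (t : ℝ) => Complex.exp ((t * (x.toAdd j : ℝ) : ℝ) * Complex.I))]
  simp only [integral_exp_int]
  split_ifs with hx
  · simp [hx]
  · obtain ⟨j, hj⟩ : ∃ j, x.toAdd j ≠ 0 := by
      by_contra! hc
      exact hx (Multiplicative.toAdd.injective (funext hc))
    rw [mul_zero]
    exact Finset.prod_eq_zero (Finset.mem_univ j) (if_neg hj)

variable {F : Finset (Multiplicative (Fin d → ℤ))} {μ : Multiplicative (Fin d → ℤ) → ℝ}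

lemma continuous_charSum : Continuous (charSum F μ) := by
  have := fun x => continuous_phase (d := d) x
  unfold charSum
  fun_prop

lemma norm_charSum_le_one (h0 : ∀ g, 0 ≤ μ g) (h1 : ∑ y ∈ F, μ y = 1) (θ : Fin d → ℝ) :
    ‖charSum F μ θ‖ ≤ 1 := by
  rw [← h1]
  refine norm_sum_le_of_le _ fun y _ => ?_
  rw [norm_mul, Complex.norm_exp_ofReal_mul_I, mul_one, Complex.norm_real, norm_of_nonneg (h0 y)]

lemma integrableOn_exp_phase_mul_charSum_pow (h0 : ∀ g, 0 ≤ μ g) (h1 : ∑ y ∈ F, μ y = 1)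
    (n : ℕ) (x : Multiplicative (Fin d → ℤ)) :
    IntegrableOn (fun θ => Complex.exp (phase θ x * Complex.I) * charSum F μ θ ^ n)
      (freqBox d) := by
  have hc := continuous_phase x
  have hφ := continuous_charSum (F := F) (μ := μ)
  refine Integrable.of_bound (C := 1) (by fun_prop) (Eventually.of_forall fun θ => ?_)
  rw [norm_mul, Complex.norm_exp_ofReal_mul_I, one_mul, norm_pow]
  exact pow_le_one₀ (norm_nonneg _) (norm_charSum_le_one h0 h1 θ)

/-- Fourier inversion for the hitting probabilities. -/
lemma integral_exp_phase_mul_charSum_pow (h0 : ∀ g, 0 ≤ μ g) (h1 : ∑ y ∈ F, μ y = 1)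
    (n : ℕ) (x : Multiplicative (Fin d → ℤ)) :
    ∫ θ in freqBox d, Complex.exp (phase θ x * Complex.I) * charSum F μ θ ^ n =
      (2 * π : ℂ) ^ d * hitProb F μ n x := by
  induction n generalizing x with
  | zero => simpa [hitProb, apply_ite] using integral_exp_phase x
  | succ n ih =>
    have h : ∀ θ, Complex.exp (phase θ x * Complex.I) * charSum F μ θ ^ (n + 1) =
        ∑ y ∈ F, (μ y : ℂ) *
          (Complex.exp (phase θ (x * y) * Complex.I) * charSum F μ θ ^ n) := by
      intro θ
      rw [pow_succ']
      nth_rewrite 1 [charSum]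
      rw [Finset.sum_mul, Finset.mul_sum]
      refine Finset.sum_congr rfl fun y _ => ?_
      rw [phase_mul, Complex.ofReal_add, add_mul, Complex.exp_add]
      ring
    simp only [h]
    rw [integral_finsetSum _ fun y _ =>
      (integrableOn_exp_phase_mul_charSum_pow h0 h1 n (x * y)).const_mul _]
    simp only [integral_const_mul, ih, hitProb_succ]
    push_cast
    rw [Finset.mul_sum]
    exact Finset.sum_congr rfl fun y _ => by ring

lemma hasSum_hitProb_mul_pow (h0 : ∀ g, 0 ≤ μ g) (h1 : ∑ y ∈ F, μ y = 1)
    {r : ℝ} (hr0 : 0 ≤ r) (hr1 : r < 1) :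
    HasSum (fun n => (2 * π : ℂ) ^ d * ((r ^ n * hitProb F μ n 1 : ℝ) : ℂ))
      (∫ θ in freqBox d, (1 - r * charSum F μ θ)⁻¹) := by
  have hle : ∀ n θ, ‖(r * charSum F μ θ) ^ n‖ ≤ r ^ n := by
    intro n θ
    rw [norm_pow, norm_mul, Complex.norm_real, norm_of_nonneg hr0]
    exact pow_le_pow_left₀ (by positivity)
      (mul_le_of_le_one_right hr0 (norm_charSum_le_one h0 h1 θ)) n
  have hφ := continuous_charSum (F := F) (μ := μ)
  have hint : ∀ n, IntegrableOn (fun θ => (r * charSum F μ θ) ^ n) (freqBox d) := fun n =>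
    Integrable.of_bound (C := r ^ n) (by fun_prop) (Eventually.of_forall (hle n))
  have hsum : Summable fun n => ∫ θ in freqBox d, ‖(r * charSum F μ θ) ^ n‖ := by
    refine Summable.of_nonneg_of_le (fun n => integral_nonneg fun θ => norm_nonneg _)
      (fun n => ?_) ((summable_geometric_of_lt_one hr0 hr1).mul_right
        ((volume.restrict (freqBox d)).real Set.univ))
    refine (integral_mono (hint n).norm (integrable_const (r ^ n)) (hle n)).trans ?_
    rw [integral_const, smul_eq_mul, mul_comm]
  have h := hasSum_integral_of_summable_integral_norm hint hsum
  have hterm : ∀ n, ∫ θ in freqBox d, (r * charSum F μ θ) ^ n =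
      (2 * π : ℂ) ^ d * ((r ^ n * hitProb F μ n 1 : ℝ) : ℂ) := by
    intro n
    have := integral_exp_phase_mul_charSum_pow h0 h1 n 1
    simp only [phase, toAdd_one, Pi.zero_apply, Int.cast_zero, mul_zero, Finset.sum_const_zero,
      Complex.ofReal_zero, zero_mul, Complex.exp_zero, one_mul] at this
    simp only [mul_pow, integral_const_mul, this]
    push_cast
    ring
  have hgeom : ∀ θ, ∑' n, (r * charSum F μ θ) ^ n = (1 - r * charSum F μ θ)⁻¹ := fun θ =>
    tsum_geometric_of_norm_lt_one <| by simpa using (hle 1 θ).trans_lt (by simpa using hr1)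
  simpa only [hterm, hgeom] using h

lemma re_inv_nonneg {z : ℂ} (hz : 0 ≤ z.re) : 0 ≤ z⁻¹.re := by
  rw [Complex.inv_re]
  exact div_nonneg hz (Complex.normSq_nonneg z)

lemma one_sub_le_re_one_sub_mul_charSum (h0 : ∀ g, 0 ≤ μ g) (h1 : ∑ y ∈ F, μ y = 1)
    {r : ℝ} (hr0 : 0 ≤ r) (θ : Fin d → ℝ) :
    1 - r ≤ (1 - r * charSum F μ θ).re := by
  have := (Complex.re_le_norm _).trans (norm_charSum_le_one h0 h1 θ)
  simp only [Complex.sub_re, Complex.one_re, Complex.re_ofReal_mul]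
  nlinarith

lemma integrableOn_inv_one_sub_mul_charSum (h0 : ∀ g, 0 ≤ μ g) (h1 : ∑ y ∈ F, μ y = 1)
    {r : ℝ} (hr0 : 0 ≤ r) (hr1 : r < 1) :
    IntegrableOn (fun θ => (1 - r * charSum F μ θ)⁻¹) (freqBox d) := by
  have hφ := continuous_charSum (F := F) (μ := μ)
  have hpos := fun θ => (sub_pos.2 hr1).trans_le (one_sub_le_re_one_sub_mul_charSum h0 h1 hr0 θ)
  have hc : Continuous fun θ => (1 - r * charSum F μ θ)⁻¹ :=
    (by fun_prop : Continuous fun θ => 1 - r * charSum F μ θ).inv₀ fun θ h => by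
      have := hpos θ
      rw [h] at this
      simp at this
  refine Integrable.of_bound (C := (1 - r)⁻¹) (by fun_prop) (Eventually.of_forall fun θ => ?_)
  rw [norm_inv]
  exact inv_anti₀ (sub_pos.2 hr1)
    ((one_sub_le_re_one_sub_mul_charSum h0 h1 hr0 θ).trans (Complex.re_le_norm _))

/-- A bound on the Green function at the origin bounds its Fourier representation. -/
lemma integral_re_inv_le (h0 : ∀ g, 0 ≤ μ g) (h1 : ∑ y ∈ F, μ y = 1)
    {B : ℝ} (hB : ∀ n, ∑ m ∈ Finset.range n, hitProb F μ m 1 ≤ B)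
    {r : ℝ} (hr0 : 0 ≤ r) (hr1 : r < 1) :
    ∫ θ in freqBox d, ((1 - r * charSum F μ θ)⁻¹).re ≤ (2 * π) ^ d * B := by
  have hs := Complex.hasSum_re (hasSum_hitProb_mul_pow h0 h1 hr0 hr1)
  have hre : ∫ θ in freqBox d, ((1 - r * charSum F μ θ)⁻¹).re =
      (∫ θ in freqBox d, (1 - r * charSum F μ θ)⁻¹).re :=
    integral_re (integrableOn_inv_one_sub_mul_charSum h0 h1 hr0 hr1)
  rw [hre]
  refine le_of_tendsto' hs.tendsto_sum_nat fun n => ?_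
  have h2 : ∀ m, ((2 * π : ℂ) ^ d * ((r ^ m * hitProb F μ m 1 : ℝ) : ℂ)).re =
      (2 * π) ^ d * (r ^ m * hitProb F μ m 1) := by
    intro m
    rw [← Complex.ofReal_re ((2 * π) ^ d * (r ^ m * hitProb F μ m 1))]
    push_cast
    rfl
  simp only [h2]
  rw [← Finset.mul_sum]
  refine mul_le_mul_of_nonneg_left ((Finset.sum_le_sum fun m _ => ?_).trans (hB n)) (by positivity)
  exact mul_le_of_le_one_left (hitProb_nonneg h0 _ _) (pow_le_one₀ hr0 hr1.le)

lemma re_inv_ge_of_abs_im_le {z : ℂ} (hz : 0 < z.re) (him : |z.im| ≤ 5 * z.re) :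
    (26 * z.re)⁻¹ ≤ z⁻¹.re := by
  rw [Complex.inv_re, Complex.normSq_apply, inv_eq_one_div, div_le_div_iff₀ (by positivity)
    (by nlinarith [mul_self_nonneg z.im])]
  have : z.im * z.im ≤ (5 * z.re) * (5 * z.re) := by
    rw [← abs_mul_abs_self]
    gcongr
  nlinarith

lemma abs_sin_sub_self_le {t : ℝ} (ht : |t| ≤ 1) : |sin t - t| ≤ 5 * (1 - cos t) := by
  have hcos := cos_le_one_sub_mul_cos_sq (ht.trans (by linarith [pi_gt_three]))
  have hsin := sin_bound ht
  have h1 : |sin t - t| ≤ t ^ 2 := by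
    have h3 : |t| ^ 3 ≤ |t| ^ 2 := pow_le_pow_of_le_one (abs_nonneg t) ht (by norm_num)
    have h5 : |t| ^ 5 ≤ |t| ^ 2 := pow_le_pow_of_le_one (abs_nonneg t) ht (by norm_num)
    calc |sin t - t| = |(sin t - (t - t ^ 3 / 6)) + -(t ^ 3 / 6)| := by ring_nf
      _ ≤ |t| ^ 5 / 100 + |t| ^ 3 / 6 := by
          refine (abs_add_le _ _).trans (add_le_add hsin (le_of_eq ?_))
          rw [abs_neg, abs_div, abs_pow]
          norm_num
      _ ≤ |t| ^ 2 := by nlinarith [sq_nonneg |t|]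
      _ = t ^ 2 := sq_abs t
  have h2 : 1 / 5 ≤ 2 / π ^ 2 := by
    rw [div_le_div_iff₀ (by norm_num) (by positivity)]
    nlinarith [pi_lt_d2, pi_pos]
  nlinarith [sq_nonneg t]

/-- A bound for the phases of the points of `F`. -/
def phaseBound (F : Finset (Multiplicative (Fin d → ℤ))) : ℝ :=
  1 + ∑ y ∈ F, ∑ j, |(y.toAdd j : ℝ)|

lemma phaseBound_pos : 0 < phaseBound F := by
  unfold phaseBound
  positivity

lemma abs_phase_le {y : Multiplicative (Fin d → ℤ)} (hy : y ∈ F) (θ : Fin d → ℝ) :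
    |phase θ y| ≤ phaseBound F * ‖θ‖ := by
  have h : ∑ j, |(y.toAdd j : ℝ)| ≤ phaseBound F :=
    (Finset.single_le_sum (f := fun y : Multiplicative (Fin d → ℤ) => ∑ j, |(y.toAdd j : ℝ)|)
      (fun _ _ => by positivity) hy).trans (le_add_of_nonneg_left zero_le_one)
  calc |phase θ y| ≤ ∑ j, ‖θ‖ * |(y.toAdd j : ℝ)| := by
        refine (Finset.abs_sum_le_sum_abs _ _).trans (Finset.sum_le_sum fun j _ => ?_)
        rw [abs_mul]
        exact mul_le_mul_of_nonneg_right (norm_le_pi_norm θ j) (abs_nonneg _)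
    _ ≤ phaseBound F * ‖θ‖ := by
        rw [← Finset.mul_sum, mul_comm]
        gcongr

lemma charSum_re (θ : Fin d → ℝ) : (charSum F μ θ).re = ∑ y ∈ F, μ y * cos (phase θ y) := by
  simp [charSum, Complex.exp_ofReal_mul_I_re]

lemma charSum_im (θ : Fin d → ℝ) : (charSum F μ θ).im = ∑ y ∈ F, μ y * sin (phase θ y) := by
  simp [charSum, Complex.exp_ofReal_mul_I_im]

lemma sum_mul_phase_eq_zero (hmean : ∀ j, ∑ y ∈ F, μ y * (y.toAdd j : ℝ) = 0)
    (θ : Fin d → ℝ) : ∑ y ∈ F, μ y * phase θ y = 0 := by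
  simp only [phase, Finset.mul_sum]
  rw [Finset.sum_comm]
  refine Finset.sum_eq_zero fun j _ => ?_
  rw [← mul_zero (θ j), ← hmean j, Finset.mul_sum]
  exact Finset.sum_congr rfl fun y _ => by ring

/-- The sector condition at low frequencies: without drift, the resolvent of the characteristic
function has real part at least of order `1 / (1 - r + ‖θ‖ ^ 2)`. -/
lemma le_re_inv_one_sub_mul_charSum (h0 : ∀ g, 0 ≤ μ g) (h1 : ∑ y ∈ F, μ y = 1)
    (hmean : ∀ j, ∑ y ∈ F, μ y * (y.toAdd j : ℝ) = 0)
    {r : ℝ} (hr0 : 0 ≤ r) (hr1 : r < 1) {θ : Fin d → ℝ} (hθ : phaseBound F * ‖θ‖ ≤ 1) :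
    (26 * (1 - r + phaseBound F ^ 2 * ‖θ‖ ^ 2))⁻¹ ≤ ((1 - r * charSum F μ θ)⁻¹).re := by
  set u := ∑ y ∈ F, μ y * (1 - cos (phase θ y)) with hu
  have hu_re : (charSum F μ θ).re = 1 - u := by
    simp only [hu, charSum_re, mul_sub, mul_one, Finset.sum_sub_distrib, h1]
    ring
  have hu0 : 0 ≤ u :=
    Finset.sum_nonneg fun y _ => mul_nonneg (h0 y) (sub_nonneg.2 (cos_le_one _))
  have hu_le : u ≤ phaseBound F ^ 2 * ‖θ‖ ^ 2 := by
    rw [← one_mul (phaseBound F ^ 2 * ‖θ‖ ^ 2), ← h1, Finset.sum_mul]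
    refine Finset.sum_le_sum fun y hy => mul_le_mul_of_nonneg_left ?_ (h0 y)
    have h2 : phase θ y ^ 2 ≤ (phaseBound F * ‖θ‖) ^ 2 := by
      rw [← sq_abs]
      exact pow_le_pow_left₀ (abs_nonneg _) (abs_phase_le hy θ) 2
    have h3 := one_sub_sq_div_two_le_cos (x := phase θ y)
    nlinarith [sq_nonneg (phase θ y)]
  have him : |(charSum F μ θ).im| ≤ 5 * u := by
    have h2 : (charSum F μ θ).im = ∑ y ∈ F, μ y * (sin (phase θ y) - phase θ y) := by
      simp only [charSum_im, mul_sub, Finset.sum_sub_distrib, sum_mul_phase_eq_zero hmean,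
        sub_zero]
    rw [h2, hu, Finset.mul_sum]
    refine (Finset.abs_sum_le_sum_abs _ _).trans (Finset.sum_le_sum fun y hy => ?_)
    rw [abs_mul, abs_of_nonneg (h0 y), mul_left_comm]
    exact mul_le_mul_of_nonneg_left (abs_sin_sub_self_le ((abs_phase_le hy θ).trans hθ)) (h0 y)
  have hre : (1 - r * charSum F μ θ).re = 1 - r + r * u := by
    simp only [Complex.sub_re, Complex.one_re, Complex.re_ofReal_mul, hu_re]
    ring
  have him' : (1 - r * charSum F μ θ).im = -(r * (charSum F μ θ).im) := by
    simp
  have hpos : 0 < 1 - r + r * u := by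
    have := mul_nonneg hr0 hu0
    linarith
  refine le_trans ?_ (re_inv_ge_of_abs_im_le (by rwa [hre]) ?_)
  · rw [hre]
    refine inv_anti₀ (by positivity) ?_
    nlinarith
  · rw [hre, him', abs_neg, abs_mul, abs_of_nonneg hr0]
    nlinarith

lemma not_integrableOn_inv_sq_norm (hd : d = 1 ∨ d = 2) {C δ : ℝ} (hC : 0 < C) (hδ : 0 < δ) :
    ¬ IntegrableOn (fun θ : Fin d → ℝ => (C * ‖θ‖ ^ 2)⁻¹) (Metric.ball 0 δ) := by
  intro h
  have : Nonempty (Fin d) := ⟨⟨0, by omega⟩⟩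
  have h2 := (integrableOn_fun_norm_addHaar (E := Fin d → ℝ) volume
    (f := fun y : ℝ => (C * y ^ 2)⁻¹)).1 h
  rw [Module.finrank_fin_fun] at h2
  have h3 : IntegrableOn (fun y : ℝ => y ^ ((d : ℝ) - 3)) (Set.Ioo 0 δ) := by
    refine IntegrableOn.congr_fun (h2.const_mul C) (fun y hy => ?_) measurableSet_Ioo
    have hy0 : y ≠ 0 := hy.1.ne'
    have hexp : (d : ℝ) - 3 = ((d - 3 : ℤ) : ℝ) := by push_cast; rfl
    rw [hexp, rpow_intCast]
    rcases hd with rfl | rfl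
    · norm_num [zpow_neg]
      field_simp
    · norm_num [zpow_neg]
      field_simp
  rw [intervalIntegral.integrableOn_Ioo_rpow_iff hδ] at h3
  rcases hd with rfl | rfl <;> norm_num at h3

/-- In dimension at most two, the Green function of a driftless walk diverges at the origin. -/
lemma not_bddAbove_sum_hitProb (hd : d = 1 ∨ d = 2) (h0 : ∀ g, 0 ≤ μ g) (h1 : ∑ y ∈ F, μ y = 1)
    (hmean : ∀ j, ∑ y ∈ F, μ y * (y.toAdd j : ℝ) = 0) (B : ℝ) :
    ∃ n, B < ∑ m ∈ Finset.range n, hitProb F μ m 1 := by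
  by_contra! hB
  set K := phaseBound F with hK
  have hK0 : 0 < K := phaseBound_pos
  set δ := min π K⁻¹ with hδ
  have hδ0 : 0 < δ := lt_min pi_pos (inv_pos.2 hK0)
  have hsub : Metric.ball (0 : Fin d → ℝ) δ ⊆ freqBox d := by
    intro θ hθ j _
    have h2 : |θ j| < π :=
      ((norm_le_pi_norm θ j).trans_lt (mem_ball_zero_iff.1 hθ)).trans_le (min_le_left _ _)
    exact ⟨(abs_lt.1 h2).1, (abs_lt.1 h2).2.le⟩
  have hKθ : ∀ θ ∈ Metric.ball (0 : Fin d → ℝ) δ, K * ‖θ‖ ≤ 1 := by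
    intro θ hθ
    have h2 : ‖θ‖ ≤ K⁻¹ := (mem_ball_zero_iff.1 hθ).le.trans (min_le_right _ _)
    calc K * ‖θ‖ ≤ K * K⁻¹ := by gcongr
      _ = 1 := mul_inv_cancel₀ hK0.ne'
  set r : ℕ → ℝ := fun n => 1 - 1 / ((n : ℝ) + 1) with hr
  have hr0 : ∀ n, 0 ≤ r n := fun n => sub_nonneg.2 <| by
    rw [div_le_one (by positivity)]
    linarith [n.cast_nonneg (α := ℝ)]
  have hr1 : ∀ n, r n < 1 := fun n => sub_lt_self _ (by positivity)
  set g : ℕ → (Fin d → ℝ) → ℝ := fun n θ => (26 * (1 - r n + K ^ 2 * ‖θ‖ ^ 2))⁻¹ with hg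
  have hgint : ∀ n, ∫⁻ θ in Metric.ball 0 δ, ENNReal.ofReal (g n θ) ≤
      ENNReal.ofReal ((2 * π) ^ d * B) := by
    intro n
    have hnn : ∀ θ, 0 ≤ ((1 - r n * charSum F μ θ)⁻¹).re := fun θ =>
      re_inv_nonneg ((sub_nonneg.2 (hr1 n).le).trans
        (one_sub_le_re_one_sub_mul_charSum h0 h1 (hr0 n) θ))
    calc ∫⁻ θ in Metric.ball 0 δ, ENNReal.ofReal (g n θ)
        ≤ ∫⁻ θ in Metric.ball 0 δ, ENNReal.ofReal ((1 - r n * charSum F μ θ)⁻¹).re :=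
          setLIntegral_mono' measurableSet_ball fun θ hθ => ENNReal.ofReal_le_ofReal
            (le_re_inv_one_sub_mul_charSum h0 h1 hmean (hr0 n) (hr1 n) (hKθ θ hθ))
      _ ≤ ∫⁻ θ in freqBox d, ENNReal.ofReal ((1 - r n * charSum F μ θ)⁻¹).re :=
          lintegral_mono_set hsub
      _ = ENNReal.ofReal (∫ θ in freqBox d, ((1 - r n * charSum F μ θ)⁻¹).re) :=
          (ofReal_integral_eq_lintegral_ofReal
            (integrableOn_inv_one_sub_mul_charSum h0 h1 (hr0 n) (hr1 n)).re
            (Eventually.of_forall hnn)).symm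
      _ ≤ _ := ENNReal.ofReal_le_ofReal (integral_re_inv_le h0 h1 hB (hr0 n) (hr1 n))
  have hlim : ∀ θ : Fin d → ℝ, ENNReal.ofReal (26 * K ^ 2 * ‖θ‖ ^ 2)⁻¹ ≤
      liminf (fun n => ENNReal.ofReal (g n θ)) atTop := by
    intro θ
    rcases eq_or_ne θ 0 with rfl | hθ
    · simp
    refine (Tendsto.liminf_eq (ENNReal.tendsto_ofReal ?_)).ge
    have h2 : 26 * (0 + K ^ 2 * ‖θ‖ ^ 2) ≠ 0 := by
      have := norm_pos_iff.2 hθ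
      positivity
    have h3 : Tendsto (fun n => 1 - r n) atTop (nhds 0) := by
      simpa [hr] using tendsto_one_div_add_atTop_nhds_zero_nat (𝕜 := ℝ)
    have h4 := ((h3.add_const (K ^ 2 * ‖θ‖ ^ 2)).const_mul 26).inv₀ h2
    rw [zero_add, ← mul_assoc] at h4
    exact h4
  refine not_integrableOn_inv_sq_norm hd (C := 26 * K ^ 2) (by positivity) hδ0 ?_
  have hmeas : Measurable fun θ : Fin d → ℝ => (26 * K ^ 2 * ‖θ‖ ^ 2)⁻¹ := by fun_prop
  refine ⟨hmeas.aestronglyMeasurable, ?_⟩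
  rw [hasFiniteIntegral_iff_ofReal (Eventually.of_forall fun θ => by positivity)]
  calc ∫⁻ θ in Metric.ball 0 δ, ENNReal.ofReal (26 * K ^ 2 * ‖θ‖ ^ 2)⁻¹
      ≤ ∫⁻ θ in Metric.ball 0 δ, liminf (fun n => ENNReal.ofReal (g n θ)) atTop :=
        lintegral_mono hlim
    _ ≤ liminf (fun n => ∫⁻ θ in Metric.ball 0 δ, ENNReal.ofReal (g n θ)) atTop :=
        lintegral_liminf_le fun n => by fun_prop
    _ ≤ ENNReal.ofReal ((2 * π) ^ d * B) :=
        liminf_le_of_le (by isBoundedDefault) fun b hb => by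
          obtain ⟨n, hn⟩ := hb.exists
          exact hn.trans (hgint n)
    _ < ⊤ := ENNReal.ofReal_lt_top

/-- A driftless walk with finitely supported steps is recurrent in dimension at most two. -/
lemma pesc_eq_zero_of_mean_zero (hd : d = 1 ∨ d = 2) (hμ : IsPMF μ)
    (hF : ∀ g, μ g ≠ 0 → g ∈ F) (hmean : ∀ j, ∑ y ∈ F, μ y * (y.toAdd j : ℝ) = 0) :
    pesc μ = 0 := by
  by_contra hne
  have h1 := hμ.sum_eq_one hF
  have hpos : 0 < pesc μ := (pesc_nonneg hμ.1 hF).lt_of_ne' hne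
  obtain ⟨n, hn⟩ := not_bddAbove_sum_hitProb hd hμ.1 h1 hmean (1 / pesc μ)
  have h2 := sum_hitProb_mul_pesc_le_one hμ.1 h1 hF n
  rw [← le_div_iff₀ hpos, Finset.sum_range_succ] at h2
  linarith [hitProb_nonneg (F := F) hμ.1 n 1]

end Fourier

/-- The positive character `x ↦ exp (t * x j)` of `ℤ^d`. -/
def expChar {d : ℕ} (t : ℝ) (j : Fin d) : Multiplicative (Fin d → ℤ) →* ℝ where
  toFun x := exp (t * (x.toAdd j : ℝ))
  map_one' := by simp
  map_mul' x y := by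
    rw [← exp_add, toAdd_mul, Pi.add_apply]
    push_cast
    ring_nf

/-- A nonzero mean yields a contracting exponential character. -/
lemma exists_sum_mul_expChar_lt_one {d : ℕ} {F : Finset (Multiplicative (Fin d → ℤ))}
    {μ : Multiplicative (Fin d → ℤ) → ℝ} (h1 : ∑ y ∈ F, μ y = 1) {j : Fin d}
    (hj : ∑ y ∈ F, μ y * (y.toAdd j : ℝ) ≠ 0) :
    ∃ t, ∑ y ∈ F, μ y * expChar t j y < 1 := by
  by_contra! h
  have hM0 : ∑ y ∈ F, μ y * expChar 0 j y = 1 := by simp [expChar, h1]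
  have hderiv : HasDerivAt (fun t => ∑ y ∈ F, μ y * expChar t j y)
      (∑ y ∈ F, μ y * (y.toAdd j : ℝ)) 0 := by
    refine HasDerivAt.fun_sum fun y _ => HasDerivAt.const_mul _ ?_
    have := ((hasDerivAt_id (0 : ℝ)).mul_const (y.toAdd j : ℝ)).exp
    simpa [expChar] using this
  refine hj (IsLocalMin.hasDerivAt_eq_zero (Eventually.of_forall fun t => ?_) hderiv)
  rw [hM0]
  exact h t

/-- Continuity of the escape probability on ℤ^d, d ∈ {1,2}, among probability
measures supported on a common finite set. -/
theorem stmt7 (d : ℕ) (hd : d = 1 ∨ d = 2)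
    (μ : Multiplicative (Fin d → ℤ) → ℝ) (μk : ℕ → Multiplicative (Fin d → ℤ) → ℝ)
    (hμ : IsPMF μ) (hμk : ∀ k, IsPMF (μk k))
    (F : Finset (Multiplicative (Fin d → ℤ)))
    (hFμ : ∀ g, μ g ≠ 0 → g ∈ F) (hFμk : ∀ k g, μk k g ≠ 0 → g ∈ F)
    (hconv : ∀ g, Tendsto (fun k => μk k g) atTop (nhds (μ g))) :
    Tendsto (fun k => pesc (μk k)) atTop (nhds (pesc μ)) := by
  by_cases hmean : ∀ j, ∑ y ∈ F, μ y * (y.toAdd j : ℝ) = 0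
  · exact tendsto_pesc_of_pesc_eq_zero (fun k => (hμk k).1) hFμ hFμk hconv
      (pesc_eq_zero_of_mean_zero hd hμ hFμ hmean)
  · push Not at hmean
    obtain ⟨j, hj⟩ := hmean
    obtain ⟨t, ht⟩ := exists_sum_mul_expChar_lt_one (hμ.sum_eq_one hFμ) hj
    exact tendsto_pesc_of_sum_mul_lt_one hμ hμk hFμ hFμk hconv (expChar t j)
      (fun x => (exp_pos _).le) ht
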